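/- Let d ≥ 1 be an integer and α ∈ (0,2). There exists a constant c = c(d,α) > 0 such that for all ξ, η ∈ ℝ^d, setting w = (ξ,η) ∈ ℝ^{2d} with |w| = (|ξ|² + |η|²)^{1/2}, one has ∫_0^1 ∫_{{y ∈ ℝ^d : |y| ≤ 1}} (1 − cos((sξ + η)·y)) |y|^{−d−α} dy ds ≥ c · min(|w|², |w|^α). -/

import Mathlib

open MeasureTheory Real RealInnerProductSpace

section TruncatedStable

open Module

variable {E : Type*} [NormedAddCommGroup E] [InnerProductSpace ℝ E]

/-- The density, with respect to Lebesgue measure, of the real part of the characteristic exponent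
of an isotropic `α`-stable process. -/
noncomputable def stableExponentDensity (α : ℝ) (v y : E) : ℝ :=
  (1 - cos ⟪v, y⟫) * ‖y‖ ^ (-(finrank ℝ E : ℝ) - α)

lemma stableExponentDensity_nonneg (α : ℝ) (v y : E) : 0 ≤ stableExponentDensity α v y :=
  mul_nonneg (by linarith [cos_le_one ⟪v, y⟫]) (by positivity)

lemma stableExponentDensity_le (α : ℝ) (v : E) {y : E} (hy : y ≠ 0) :
    stableExponentDensity α v y ≤ ‖v‖ ^ 2 / 2 * ‖y‖ ^ (-((finrank ℝ E : ℝ) + α - 2)) := by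
  have hy' : 0 < ‖y‖ := norm_pos_iff.mpr hy
  have hcos : 1 - cos ⟪v, y⟫ ≤ ‖v‖ ^ 2 / 2 * ‖y‖ ^ 2 := by
    have h1 := one_sub_sq_div_two_le_cos (x := ⟪v, y⟫)
    have h2 : ⟪v, y⟫ ^ 2 ≤ (‖v‖ * ‖y‖) ^ 2 :=
      sq_le_sq' (neg_le_of_abs_le (abs_real_inner_le_norm v y)) (real_inner_le_norm v y)
    nlinarith
  calc stableExponentDensity α v y
      ≤ ‖v‖ ^ 2 / 2 * ‖y‖ ^ 2 * ‖y‖ ^ (-(finrank ℝ E : ℝ) - α) := by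
        unfold stableExponentDensity
        gcongr
    _ = ‖v‖ ^ 2 / 2 * ‖y‖ ^ (-((finrank ℝ E : ℝ) + α - 2)) := by
        rw [mul_assoc, ← rpow_natCast ‖y‖ 2, ← rpow_add hy']
        congr 2
        push_cast
        ring

/-- On one of two fixed intervals of length `1 / 3`, the segment `s ↦ s • ξ + η` stays away from
the origin. -/
lemma exists_interval_norm_smul_add_ge (ξ η : E) :
    ∃ a : ℝ, 0 ≤ a ∧ a + 1 / 3 ≤ 1 ∧
      ∀ s ∈ Set.Icc a (a + 1 / 3), √(‖ξ‖ ^ 2 + ‖η‖ ^ 2) / 7 ≤ ‖s • ξ + η‖ := by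
  by_contra! h
  obtain ⟨s, ⟨hs₀, hs₁⟩, hs⟩ := h 0 le_rfl (by norm_num)
  obtain ⟨t, ⟨ht₀, ht₁⟩, ht⟩ := h (2 / 3) (by norm_num) (by norm_num)
  set w := √(‖ξ‖ ^ 2 + ‖η‖ ^ 2) with hw
  have hw_sq : w ^ 2 = ‖ξ‖ ^ 2 + ‖η‖ ^ 2 := sq_sqrt (by positivity)
  have hw₀ : 0 ≤ w := sqrt_nonneg _
  have hξ : (t - s) * ‖ξ‖ ≤ ‖t • ξ + η‖ + ‖s • ξ + η‖ := by
    rw [← norm_of_nonneg (by linarith : 0 ≤ t - s), ← norm_smul]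
    refine le_of_eq_of_le ?_ (norm_sub_le _ _)
    congr 1
    module
  have hη : ‖η‖ ≤ ‖s • ξ + η‖ + s * ‖ξ‖ := by
    rw [← norm_of_nonneg hs₀, ← norm_smul]
    refine le_of_eq_of_le ?_ (norm_sub_le _ _)
    simp [abs_of_nonneg hs₀]
  have hξ' : ‖ξ‖ ≤ 6 / 7 * w := by nlinarith [norm_nonneg ξ]
  have hη' : ‖η‖ ≤ 3 / 7 * w := by nlinarith [norm_nonneg ξ]
  have hw_pos : 0 < w := by linarith [norm_nonneg (s • ξ + η)]
  nlinarith [norm_nonneg ξ, norm_nonneg η]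

variable [FiniteDimensional ℝ E] [MeasurableSpace E] [BorelSpace E]

/-- The real part of the characteristic exponent of the part of an isotropic `α`-stable process
with jumps of size at most one. -/
noncomputable def truncatedStableExponent (α : ℝ) (v : E) : ℝ :=
  ∫ y in {y : E | ‖y‖ ≤ 1}, stableExponentDensity α v y

lemma measurable_stableExponentDensity (α : ℝ) :
    Measurable fun p : E × E ↦ stableExponentDensity α p.1 p.2 := by
  unfold stableExponentDensity
  fun_prop

lemma integrableOn_norm_rpow_unitBall [Nontrivial E] {α : ℝ} (hα : α < 2) :
    IntegrableOn (fun y : E ↦ ‖y‖ ^ (-((finrank ℝ E : ℝ) + α - 2))) {y | ‖y‖ ≤ 1} := by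
  refine (integrableOn_ball_of_norm_le_rpow (C := 1) (α := (finrank ℝ E : ℝ) + α - 2) (r := 2)
    (Nat.one_le_iff_ne_zero.mpr finrank_pos.ne') (by linarith)
    (Filter.Eventually.of_forall fun y ↦ ?_) ?_).mono_set fun y hy ↦ ?_
  · rw [one_mul, norm_of_nonneg (by positivity)]
  · exact Measurable.aestronglyMeasurable (by fun_prop)
  · rw [mem_ball_zero_iff]
    exact lt_of_le_of_lt hy one_lt_two

lemma ae_stableExponentDensity_le [Nontrivial E] (α : ℝ) (v : E) :
    ∀ᵐ y ∂volume.restrict {y : E | ‖y‖ ≤ 1}, stableExponentDensity α v y ≤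
      ‖v‖ ^ 2 / 2 * ‖y‖ ^ (-((finrank ℝ E : ℝ) + α - 2)) := by
  refine ae_restrict_of_ae ?_
  filter_upwards [compl_mem_ae_iff.mpr (measure_singleton (0 : E))] with y hy
  exact stableExponentDensity_le α v hy

lemma integrableOn_stableExponentDensity [Nontrivial E] {α : ℝ} (hα : α < 2) (v : E) :
    IntegrableOn (stableExponentDensity α v) {y : E | ‖y‖ ≤ 1} := by
  refine ((integrableOn_norm_rpow_unitBall hα).const_mul (‖v‖ ^ 2 / 2)).mono'
    ((measurable_stableExponentDensity α).comp measurable_prodMk_left).aestronglyMeasurable ?_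
  filter_upwards [ae_stableExponentDensity_le α v] with y hy
  rwa [norm_of_nonneg (stableExponentDensity_nonneg α v y)]

lemma truncatedStableExponent_nonneg (α : ℝ) (v : E) : 0 ≤ truncatedStableExponent α v :=
  integral_nonneg (stableExponentDensity_nonneg α v)

lemma truncatedStableExponent_le [Nontrivial E] {α : ℝ} (hα : α < 2) (v : E) :
    truncatedStableExponent α v ≤ ‖v‖ ^ 2 / 2 *
      ∫ y in {y : E | ‖y‖ ≤ 1}, ‖y‖ ^ (-((finrank ℝ E : ℝ) + α - 2)) := by
  rw [← integral_const_mul]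
  exact integral_mono_ae (integrableOn_stableExponentDensity hα v)
    ((integrableOn_norm_rpow_unitBall hα).const_mul _) (ae_stableExponentDensity_le α v)

lemma measurable_truncatedStableExponent (α : ℝ) :
    Measurable (truncatedStableExponent α : E → ℝ) :=
  (measurable_stableExponentDensity α).stronglyMeasurable.integral_prod_right'.measurable

lemma intervalIntegrable_truncatedStableExponent [Nontrivial E] {α : ℝ} (hα : α < 2) (ξ η : E) :
    IntervalIntegrable (fun s : ℝ ↦ truncatedStableExponent α (s • ξ + η)) volume 0 1 := by
  refine IntervalIntegrable.mono_fun' (g := fun s : ℝ ↦ ‖s • ξ + η‖ ^ 2 / 2 *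
    ∫ y in {y : E | ‖y‖ ≤ 1}, ‖y‖ ^ (-((finrank ℝ E : ℝ) + α - 2)))
    (Continuous.intervalIntegrable (by fun_prop) _ _)
    ((measurable_truncatedStableExponent α).comp (by fun_prop)).aestronglyMeasurable
    (Filter.Eventually.of_forall fun s ↦ ?_)
  simp only [norm_of_nonneg (truncatedStableExponent_nonneg α _)]
  exact truncatedStableExponent_le hα (_ : E)

/-- Only jumps close to `r / 2` times the direction of `v` are used for the bound. -/
lemma le_truncatedStableExponent_of_mul_le [Nontrivial E] {α : ℝ} (hα₀ : 0 < α) (hα : α < 2)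
    {v : E} (hv : v ≠ 0) {r : ℝ} (hr : 0 < r) (hr₁ : r ≤ 1) (hvr : ‖v‖ * r ≤ 1) :
    volume.real (Metric.closedBall (0 : E) 1) / (8 * π ^ 2 * 4 ^ finrank ℝ E) *
      (‖v‖ ^ 2 * r ^ (2 - α)) ≤ truncatedStableExponent α v := by
  have hv' : 0 < ‖v‖ := norm_pos_iff.mpr hv
  set x : E := (r / (2 * ‖v‖)) • v with hx
  have hx_norm : ‖x‖ = r / 2 := by
    rw [hx, norm_smul, norm_of_nonneg (by positivity)]
    field_simp
  have hx_inner : ⟪v, x⟫ = ‖v‖ * r / 2 := by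
    rw [hx, inner_smul_right, real_inner_self_eq_norm_sq]
    field_simp
  have hball : ∀ y ∈ Metric.closedBall x (r / 4), ‖y‖ ≤ r ∧ 0 < ‖y‖ ∧ ‖v‖ * r / 4 ≤ ⟪v, y⟫ := by
    intro y hy
    rw [mem_closedBall_iff_norm] at hy
    have h1 : ‖y‖ ≤ ‖y - x‖ + ‖x‖ := by simpa using norm_add_le (y - x) x
    have h2 : ‖x‖ ≤ ‖y - x‖ + ‖y‖ := by
      simpa [norm_sub_rev] using norm_add_le (x - y) y
    have h3 : ⟪v, y⟫ = ⟪v, y - x⟫ + ⟪v, x⟫ := by rw [← inner_add_right, sub_add_cancel]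
    have h4 := neg_le_of_abs_le (abs_real_inner_le_norm v (y - x))
    have h5 : ‖v‖ * ‖y - x‖ ≤ ‖v‖ * (r / 4) := by gcongr
    exact ⟨by linarith, by linarith, by linarith⟩
  have hsub : Metric.closedBall x (r / 4) ⊆ {y : E | ‖y‖ ≤ 1} :=
    fun y hy ↦ (hball y hy).1.trans hr₁
  have hlower : ∀ y ∈ Metric.closedBall x (r / 4),
      2 / π ^ 2 * (‖v‖ * r / 4) ^ 2 * r ^ (-(finrank ℝ E : ℝ) - α) ≤
        stableExponentDensity α v y := by
    intro y hy
    obtain ⟨hyr, hy₀, hvy⟩ := hball y hy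
    have hle : |⟪v, y⟫| ≤ π := calc
      |⟪v, y⟫| ≤ ‖v‖ * ‖y‖ := abs_real_inner_le_norm v y
      _ ≤ ‖v‖ * r := by gcongr
      _ ≤ π := by linarith [pi_gt_three]
    have hcos : 2 / π ^ 2 * ⟪v, y⟫ ^ 2 ≤ 1 - cos ⟪v, y⟫ := by
      linarith [cos_le_one_sub_mul_cos_sq hle]
    have hcos' : 2 / π ^ 2 * (‖v‖ * r / 4) ^ 2 ≤ 1 - cos ⟪v, y⟫ :=
      le_trans (by gcongr) hcos
    exact mul_le_mul hcos' (rpow_le_rpow_of_nonpos hy₀ hyr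
      (by linarith [(finrank ℝ E).cast_nonneg (α := ℝ)])) (by positivity)
      (le_trans (by positivity) hcos')
  have hint := integrableOn_stableExponentDensity hα v
  have hpow : r ^ (2 - α) = r ^ 2 * (r ^ finrank ℝ E * r ^ (-(finrank ℝ E : ℝ) - α)) := by
    rw [← rpow_natCast r 2, ← rpow_natCast r (finrank ℝ E), ← rpow_add hr, ← rpow_add hr]
    congr 1
    push_cast
    ring
  calc _ = 2 / π ^ 2 * (‖v‖ * r / 4) ^ 2 * r ^ (-(finrank ℝ E : ℝ) - α) *
        volume.real (Metric.closedBall x (r / 4)) := by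
        rw [Measure.addHaar_real_closedBall' volume x (by positivity : 0 ≤ r / 4), hpow, div_pow r]
        ring
    _ ≤ ∫ y in Metric.closedBall x (r / 4), stableExponentDensity α v y :=
        setIntegral_ge_of_const_le_real Metric.isClosed_closedBall.measurableSet
          measure_closedBall_lt_top.ne hlower (hint.mono_set hsub)
    _ ≤ truncatedStableExponent α v :=
        setIntegral_mono_set hint
          (Filter.Eventually.of_forall (stableExponentDensity_nonneg α v)) hsub.eventuallyLE

lemma exists_mul_min_le_truncatedStableExponent [Nontrivial E] {α : ℝ} (hα₀ : 0 < α)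
    (hα : α < 2) :
    ∃ c > 0, ∀ v : E, c * min (‖v‖ ^ (2 : ℝ)) (‖v‖ ^ α) ≤ truncatedStableExponent α v := by
  have hvol : 0 < volume.real (Metric.closedBall (0 : E) 1) :=
    ENNReal.toReal_pos (Metric.measure_closedBall_pos _ _ one_pos).ne'
      measure_closedBall_lt_top.ne
  refine ⟨volume.real (Metric.closedBall (0 : E) 1) / (8 * π ^ 2 * 4 ^ finrank ℝ E),
    by positivity, fun v ↦ ?_⟩
  rcases eq_or_ne v 0 with rfl | hv
  · simpa [zero_rpow hα₀.ne'] using truncatedStableExponent_nonneg α (0 : E)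
  have hv' : 0 < ‖v‖ := norm_pos_iff.mpr hv
  rcases le_total ‖v‖ 1 with h | h
  · refine le_trans ?_ (le_truncatedStableExponent_of_mul_le hα₀ hα hv one_pos le_rfl (by simpa))
    gcongr
    refine (min_le_left _ _).trans_eq ?_
    simp
  · refine le_trans ?_ (le_truncatedStableExponent_of_mul_le hα₀ hα hv (inv_pos.mpr hv')
      (inv_le_one_of_one_le₀ h) (mul_inv_cancel₀ hv'.ne').le)
    gcongr
    refine (min_le_right _ _).trans_eq ?_
    rw [inv_rpow hv'.le, ← rpow_neg hv'.le, ← rpow_natCast ‖v‖ 2, ← rpow_add hv']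
    congr 1
    push_cast
    ring

/-- Averaging over a segment preserves the lower bound for the truncated exponent. -/
lemma exists_mul_min_le_integral_truncatedStableExponent [Nontrivial E] {α : ℝ} (hα₀ : 0 < α)
    (hα : α < 2) :
    ∃ c > 0, ∀ ξ η : E,
      c * min (√(‖ξ‖ ^ 2 + ‖η‖ ^ 2) ^ (2 : ℝ)) (√(‖ξ‖ ^ 2 + ‖η‖ ^ 2) ^ α) ≤
        ∫ s in (0 : ℝ)..1, truncatedStableExponent α (s • ξ + η) := by
  obtain ⟨c, hc, hle⟩ := exists_mul_min_le_truncatedStableExponent (E := E) hα₀ hα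
  refine ⟨c / 147, by positivity, fun ξ η ↦ ?_⟩
  obtain ⟨a, ha₀, ha₁, ha⟩ := exists_interval_norm_smul_add_ge ξ η
  set w := √(‖ξ‖ ^ 2 + ‖η‖ ^ 2) with hw
  have hw₀ : 0 ≤ w := sqrt_nonneg _
  have hmin : min (w ^ (2 : ℝ)) (w ^ α) / 49 ≤ min ((w / 7) ^ (2 : ℝ)) ((w / 7) ^ α) := by
    have h7 : (7 : ℝ) ^ α ≤ 49 := calc
      (7 : ℝ) ^ α ≤ 7 ^ (2 : ℝ) := rpow_le_rpow_of_exponent_le (by norm_num) hα.le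
      _ = 49 := by norm_num
    rw [div_rpow hw₀ (by norm_num), div_rpow hw₀ (by norm_num)]
    refine le_min ?_ ?_
    · rw [show (7 : ℝ) ^ (2 : ℝ) = 49 by norm_num]
      gcongr
      exact min_le_left _ _
    · gcongr
      exact min_le_right _ _
  have hint := intervalIntegrable_truncatedStableExponent hα ξ η
  have hsub : Set.uIcc a (a + 1 / 3) ⊆ Set.uIcc 0 1 := by
    rw [Set.uIcc_of_le (by linarith), Set.uIcc_of_le zero_le_one]
    exact Set.Icc_subset_Icc ha₀ ha₁
  calc c / 147 * min (w ^ (2 : ℝ)) (w ^ α)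
      = ∫ _ in a..(a + 1 / 3), c * (min (w ^ (2 : ℝ)) (w ^ α) / 49) := by
        rw [intervalIntegral.integral_const, smul_eq_mul]
        ring
    _ ≤ ∫ s in a..(a + 1 / 3), truncatedStableExponent α (s • ξ + η) := by
        refine intervalIntegral.integral_mono_on (by linarith) intervalIntegrable_const
          (hint.mono_set hsub) fun s hs ↦ le_trans ?_ (hle _)
        have hs' := ha s hs
        have hw₇ : 0 ≤ w / 7 := by positivity
        gcongr
        exact hmin.trans (min_le_min (rpow_le_rpow hw₇ hs' zero_le_two)
          (rpow_le_rpow hw₇ hs' hα₀.le))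
    _ ≤ ∫ s in (0 : ℝ)..1, truncatedStableExponent α (s • ξ + η) :=
        intervalIntegral.integral_mono_interval ha₀ (by linarith) ha₁
          (Filter.Eventually.of_forall fun s ↦ truncatedStableExponent_nonneg α _) hint

end TruncatedStable

/-- lower bound on the time-averaged real part of the characteristic
exponent of the small-jump part. -/
theorem stmt_0 (d : ℕ) (hd : 1 ≤ d) (α : ℝ) (hα : α ∈ Set.Ioo (0 : ℝ) 2) :
    ∃ c > (0 : ℝ), ∀ ξ η : EuclideanSpace ℝ (Fin d),
      c * min (Real.sqrt (‖ξ‖ ^ 2 + ‖η‖ ^ 2) ^ (2 : ℝ))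
          (Real.sqrt (‖ξ‖ ^ 2 + ‖η‖ ^ 2) ^ α) ≤
        ∫ s in (0 : ℝ)..1,
          ∫ y in {y : EuclideanSpace ℝ (Fin d) | ‖y‖ ≤ 1},
            (1 - Real.cos ⟪s • ξ + η, y⟫) * ‖y‖ ^ (-(d : ℝ) - α) := by
  have : Nonempty (Fin d) := ⟨⟨0, hd⟩⟩
  simpa only [truncatedStableExponent, stableExponentDensity, finrank_euclideanSpace_fin] using
    exists_mul_min_le_integral_truncatedStableExponent (E := EuclideanSpace ℝ (Fin d)) hα.1 hα.2
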